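/- arXiv:1302.6289 — 5 statements merged into one kernel-verified Lean document; each statement's English description precedes it below -/
import Mathlib

section
/- For every trajectory (u, x) of the plant with output sequence y, every time t ∈ ℕ, and every window length j with 1 ≤ j and j + 1 ≤ t, the feasible state sets are nested: S_{j+1}(t) ⊆ S_j(t). -/
/-- Cocycle property: a flow determined by its one-step recursion may be restarted at any
intermediate time. -/
theorem flow_restart {X U : Type*} {f : U → X → X} {u : ℕ → U} {Φ : ℕ → ℕ → X → X}
    (hΦ0 : ∀ (a : ℕ) (x₀ : X), Φ a a x₀ = x₀)
    (hΦ1 : ∀ (a b : ℕ) (x₀ : X), a ≤ b → Φ a (b + 1) x₀ = f (u b) (Φ a b x₀))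
    {a c b : ℕ} (hac : a ≤ c) (hcb : c ≤ b) (x₀ : X) :
    Φ c b (Φ a c x₀) = Φ a b x₀ := by
  induction b, hcb using Nat.le_induction with
  | base => exact hΦ0 c _
  | succ b hcb ih => rw [hΦ1 c b _ hcb, hΦ1 a b _ (hac.trans hcb), ih]

/-- Core of Proposition 4: the window-`(j+1)` feasible state set is contained in
the window-`j` feasible state set. -/
theorem feasible_set_nested
    {X U Y : Type*} (f : U → X → X) (g : X → Y)
    (u : ℕ → U) (x : ℕ → X) (y : ℕ → Y)
    (hx : ∀ t, x (t + 1) = f (u t) (x t))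
    (hy : ∀ t, y t = g (x t))
    (Φ : ℕ → ℕ → X → X)
    (hΦ0 : ∀ (a : ℕ) (x₀ : X), Φ a a x₀ = x₀)
    (hΦ1 : ∀ (a b : ℕ) (x₀ : X), a ≤ b → Φ a (b + 1) x₀ = f (u b) (Φ a b x₀))
    (t j : ℕ) (hj1 : 1 ≤ j) (hjt : j + 1 ≤ t) :
    {xt : X | ∃ x₀ : X, xt = Φ (t - (j + 1)) t x₀ ∧
      ∀ s, t - (j + 1) ≤ s → s ≤ t - 1 → g (Φ (t - (j + 1)) s x₀) = y s} ⊆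
    {xt : X | ∃ x₀ : X, xt = Φ (t - j) t x₀ ∧
      ∀ s, t - j ≤ s → s ≤ t - 1 → g (Φ (t - j) s x₀) = y s} := by
  rintro _ ⟨x₀, rfl, hout⟩
  have hle : t - (j + 1) ≤ t - j := by omega
  refine ⟨Φ (t - (j + 1)) (t - j) x₀,
    (flow_restart hΦ0 hΦ1 hle (Nat.sub_le t j) x₀).symm, fun s hs hst => ?_⟩
  rw [flow_restart hΦ0 hΦ1 hle hs]
  exact hout s (hle.trans hs) hst
end

section
/- Let h : X → V and μ : V → ℝ be functions. For every trajectory (u, x) of the plant with output sequence y, every time t ∈ ℕ, and every window length j with 1 ≤ j ≤ t, if the image set (μ ∘ h) '' S_j(t) is bounded above in ℝ, then μ(h(x(t))) ≤ sSup ((μ ∘ h) '' S_j(t)). -/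
/-- Proposition 3: the true performance weight is bounded by the worst-case
performance weight over the window-`j` feasible state set. -/
theorem mu_le_sSup_feasible
    {X U Y V : Type*} (f : U → X → X) (g : X → Y)
    (h : X → V) (μ : V → ℝ)
    (u : ℕ → U) (x : ℕ → X) (y : ℕ → Y)
    (hx : ∀ t, x (t + 1) = f (u t) (x t))
    (hy : ∀ t, y t = g (x t))
    (Φ : ℕ → ℕ → X → X)
    (hΦ0 : ∀ (a : ℕ) (x₀ : X), Φ a a x₀ = x₀)
    (hΦ1 : ∀ (a b : ℕ) (x₀ : X), a ≤ b → Φ a (b + 1) x₀ = f (u b) (Φ a b x₀))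
    (t j : ℕ) (hj1 : 1 ≤ j) (hjt : j ≤ t)
    (S : Set X)
    (hS : S = {xt : X | ∃ x₀ : X, xt = Φ (t - j) t x₀ ∧
      ∀ s, t - j ≤ s → s ≤ t - 1 → g (Φ (t - j) s x₀) = y s})
    (hbdd : BddAbove ((μ ∘ h) '' S)) :
    μ (h (x t)) ≤ sSup ((μ ∘ h) '' S) := by
  have key : ∀ s, t - j ≤ s → Φ (t - j) s (x (t - j)) = x s := by
    intro s hs
    induction s, hs using Nat.le_induction with
    | base => exact hΦ0 _ _
    | succ b hb ih => rw [hΦ1 _ _ _ hb, ih, hx]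
  have hmem : x t ∈ S := by
    rw [hS]
    exact ⟨x (t - j), (key t (Nat.sub_le t j)).symm, fun s hs _ => by rw [key s hs, hy]⟩
  exact le_csSup hbdd ⟨x t, hmem, rfl⟩
end

section
/- Let h : X → V and μ : V → ℝ be functions. For every trajectory (u, x) of the plant with output sequence y, every time t ∈ ℕ, and every window length j with 1 ≤ j and j + 1 ≤ t, if the image set (μ ∘ h) '' S_j(t) is bounded above in ℝ, then the chain of inequalities μ(h(x(t))) ≤ sSup ((μ ∘ h) '' S_{j+1}(t)) ≤ sSup ((μ ∘ h) '' S_j(t)) holds. -/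
/-- A flow generated by one-step maps satisfies the cocycle identity. -/
theorem flow_comp {U X : Type*} {f : U → X → X} {u : ℕ → U} {Φ : ℕ → ℕ → X → X}
    (hΦ0 : ∀ (a : ℕ) (x₀ : X), Φ a a x₀ = x₀)
    (hΦ1 : ∀ (a b : ℕ) (x₀ : X), a ≤ b → Φ a (b + 1) x₀ = f (u b) (Φ a b x₀))
    {a b c : ℕ} (hab : a ≤ b) (hbc : b ≤ c) (x₀ : X) :
    Φ b c (Φ a b x₀) = Φ a c x₀ := by
  induction c, hbc using Nat.le_induction with
  | base => exact hΦ0 b _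
  | succ c hbc ih => rw [hΦ1 b c _ hbc, hΦ1 a c _ (hab.trans hbc), ih]

/-- A flow generated by one-step maps carries a trajectory along itself. -/
theorem flow_trajectory {U X : Type*} {f : U → X → X} {u : ℕ → U} {x : ℕ → X}
    {Φ : ℕ → ℕ → X → X} (hx : ∀ t, x (t + 1) = f (u t) (x t))
    (hΦ0 : ∀ (a : ℕ) (x₀ : X), Φ a a x₀ = x₀)
    (hΦ1 : ∀ (a b : ℕ) (x₀ : X), a ≤ b → Φ a (b + 1) x₀ = f (u b) (Φ a b x₀))
    {a b : ℕ} (hab : a ≤ b) : Φ a b (x a) = x b := by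
  induction b, hab using Nat.le_induction with
  | base => exact hΦ0 a _
  | succ b hab ih => rw [hΦ1 a b _ hab, ih, hx]


/-- Lemma 3: the chain `μ(v(t)) ≤ μ(v̂_{i+1}(t)) ≤ μ(v̂_i(t))` of worst-case
performance weights over nested feasible state sets. -/
theorem mu_chain_feasible
    {X U Y V : Type*} (f : U → X → X) (g : X → Y)
    (h : X → V) (μ : V → ℝ)
    (u : ℕ → U) (x : ℕ → X) (y : ℕ → Y)
    (hx : ∀ t, x (t + 1) = f (u t) (x t))
    (hy : ∀ t, y t = g (x t))
    (Φ : ℕ → ℕ → X → X)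
    (hΦ0 : ∀ (a : ℕ) (x₀ : X), Φ a a x₀ = x₀)
    (hΦ1 : ∀ (a b : ℕ) (x₀ : X), a ≤ b → Φ a (b + 1) x₀ = f (u b) (Φ a b x₀))
    (t j : ℕ) (hj1 : 1 ≤ j) (hjt : j + 1 ≤ t)
    (S₁ S₂ : Set X)
    (hS₁ : S₁ = {xt : X | ∃ x₀ : X, xt = Φ (t - j) t x₀ ∧
      ∀ s, t - j ≤ s → s ≤ t - 1 → g (Φ (t - j) s x₀) = y s})
    (hS₂ : S₂ = {xt : X | ∃ x₀ : X, xt = Φ (t - (j + 1)) t x₀ ∧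
      ∀ s, t - (j + 1) ≤ s → s ≤ t - 1 → g (Φ (t - (j + 1)) s x₀) = y s})
    (hbdd : BddAbove ((μ ∘ h) '' S₁)) :
    μ (h (x t)) ≤ sSup ((μ ∘ h) '' S₂) ∧
      sSup ((μ ∘ h) '' S₂) ≤ sSup ((μ ∘ h) '' S₁) := by
  have hsub : S₂ ⊆ S₁ := by
    rw [hS₁, hS₂]
    rintro _ ⟨x₀, rfl, hout⟩
    have hle : t - (j + 1) ≤ t - j := by omega
    refine ⟨Φ (t - (j + 1)) (t - j) x₀, (flow_comp hΦ0 hΦ1 hle (Nat.sub_le t j) x₀).symm, ?_⟩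
    intro s hs hst
    rw [flow_comp hΦ0 hΦ1 hle hs]
    exact hout s (hle.trans hs) hst
  have hmem : x t ∈ S₂ := by
    rw [hS₂]
    refine ⟨x (t - (j + 1)), (flow_trajectory hx hΦ0 hΦ1 (Nat.sub_le t (j + 1))).symm, ?_⟩
    intro s hs _
    rw [flow_trajectory hx hΦ0 hΦ1 hs, hy]
  have himage := Set.image_mono (f := μ ∘ h) hsub
  have hmem' : μ (h (x t)) ∈ (μ ∘ h) '' S₂ := Set.mem_image_of_mem (μ ∘ h) hmem
  exact ⟨le_csSup (hbdd.mono himage) hmem', csSup_le_csSup hbdd ⟨_, hmem'⟩ himage⟩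
end

section
/- Let Q and A be finite nonempty types, f : Q → A → Q a transition map, and c : Q → A → ℝ a cost function. Suppose every cycle has nonnegative total cost: for every q ∈ Q, every k ∈ ℕ, and every word a : Fin (k+1) → A, if the trajectory defined by q₀ = q and q_{m+1} = f(q_m, a(m)) satisfies q_{k+1} = q, then ∑_{m=0}^{k} c(q_m, a(m)) ≥ 0. Then for every initial state q ∈ Q and every infinite input sequence a : ℕ → A, the trajectory q(0) = q, q(t+1) = f(q(t), a(t)) has partial sums bounded below: the set { ∑_{t=0}^{T} c(q(t), a(t)) : T ∈ ℕ } is bounded below in ℝ. -/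
/-- A trajectory restarted at time `m` is the trajectory of the shifted input. -/
theorem traj_add_eq_traj_shift {Q A : Type*} (f : Q → A → Q) (traj : Q → (ℕ → A) → ℕ → Q)
    (htraj0 : ∀ (q : Q) (a : ℕ → A), traj q a 0 = q)
    (htrajs : ∀ (q : Q) (a : ℕ → A) (m : ℕ), traj q a (m + 1) = f (traj q a m) (a m))
    (q : Q) (a : ℕ → A) (m n : ℕ) :
    traj q a (m + n) = traj (traj q a m) (fun i => a (m + i)) n := by
  induction n with
  | zero => rw [htraj0, Nat.add_zero]
  | succ n ih => rw [← Nat.add_assoc, htrajs, htrajs, ih]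

/-- If a sequence with finitely many labels never decreases from one index to a later index with
the same label, then it is bounded below. -/
theorem bddBelow_range_of_le_of_label_eq {Q : Type*} [Finite Q] (x : ℕ → Q) (S : ℕ → ℝ)
    (h : ∀ m n, m < n → x m = x n → S m ≤ S n) : BddBelow (Set.range S) := by
  have hlabel : ∀ s, ∃ b, ∀ n, x n = s → b ≤ S n := by
    intro s
    classical
    by_cases hs : ∃ n, x n = s
    · refine ⟨S (Nat.find hs), fun n hn => ?_⟩
      rcases (Nat.find_min' hs hn).eq_or_lt with heq | hlt
      · rw [heq]
      · exact h _ _ hlt ((Nat.find_spec hs).trans hn.symm)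
    · exact ⟨0, fun n hn => (hs ⟨n, hn⟩).elim⟩
  choose b hb using hlabel
  obtain ⟨B, hB⟩ := (Set.finite_range b).bddBelow
  refine ⟨B, ?_⟩
  rintro _ ⟨n, rfl⟩
  exact (hB ⟨x n, rfl⟩).trans (hb _ n rfl)


/-- 0-reduction lemma (cycle characterization, sufficiency direction): if every
cycle of a deterministic finite state machine has nonnegative total cost, then
every trajectory has partial sums bounded below. -/
theorem partial_sums_bddBelow_of_nonneg_cycles
    {Q A : Type*} [Fintype Q] [Fintype A] [Nonempty Q] [Nonempty A]
    (f : Q → A → Q) (c : Q → A → ℝ)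
    (traj : Q → (ℕ → A) → ℕ → Q)
    (htraj0 : ∀ (q : Q) (a : ℕ → A), traj q a 0 = q)
    (htrajs : ∀ (q : Q) (a : ℕ → A) (m : ℕ),
      traj q a (m + 1) = f (traj q a m) (a m))
    (hcycle : ∀ (q : Q) (k : ℕ) (a : ℕ → A), traj q a (k + 1) = q →
      0 ≤ ∑ m ∈ Finset.range (k + 1), c (traj q a m) (a m)) :
    ∀ (q : Q) (a : ℕ → A),
      BddBelow (Set.range fun T : ℕ =>
        ∑ t ∈ Finset.range (T + 1), c (traj q a t) (a t)) := by
  intro q a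
  have hbdd : BddBelow (Set.range fun n : ℕ =>
      ∑ t ∈ Finset.range n, c (traj q a t) (a t)) := by
    refine bddBelow_range_of_le_of_label_eq (traj q a) _ fun m n hmn hx => ?_
    obtain ⟨k, rfl⟩ := Nat.exists_eq_add_of_lt hmn
    have hshift := traj_add_eq_traj_shift f traj htraj0 htrajs q a m
    have hc := hcycle (traj q a m) k (fun i => a (m + i))
      ((hshift (k + 1)).symm.trans hx.symm)
    simp only [← hshift] at hc
    simp only [Nat.add_assoc, Finset.sum_range_add _ m (k + 1)]
    exact le_add_of_nonneg_right hc
  refine hbdd.mono ?_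
  rintro _ ⟨T, rfl⟩
  exact ⟨T + 1, rfl⟩
end

section
/- Let G : ((ℕ → U) × (ℕ → Y)) → (ℕ → Y) be strictly causal: for all pairs (u, y) and (u', y') and all t ∈ ℕ, if u(s) = u'(s) and y(s) = y'(s) for all s < t, then G(u, y)(t) = G(u', y')(t). Suppose there exists T* ≥ 1 such that for every trajectory (u, x) of the plant with output sequence y, G(u, y)(t) = y(t) for all t ≥ T* (G perfectly predicts the sensor output after time T*). Then for every trajectory (u, x) with output y and every t ≥ T*, the window-T* feasible output set is a singleton: g '' S_{T*}(t) = {y(t)}. -/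
/-- Completeness theorem (core claim): if a strictly causal predictor `G`
perfectly predicts the sensor output after time `T*`, then for `t ≥ T*` the
window-`T*` feasible output set is the singleton `{y(t)}`. -/
theorem feasible_output_singleton_of_perfect_predictor
    {X U Y : Type*} (f : U → X → X) (g : X → Y)
    (Φ : (ℕ → U) → ℕ → ℕ → X → X)
    (hΦ0 : ∀ (u : ℕ → U) (a : ℕ) (x₀ : X), Φ u a a x₀ = x₀)
    (hΦ1 : ∀ (u : ℕ → U) (a b : ℕ) (x₀ : X), a ≤ b →
      Φ u a (b + 1) x₀ = f (u b) (Φ u a b x₀))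
    (G : ((ℕ → U) × (ℕ → Y)) → ℕ → Y)
    (hcausal : ∀ (u u' : ℕ → U) (y y' : ℕ → Y) (t : ℕ),
      (∀ s < t, u s = u' s ∧ y s = y' s) → G (u, y) t = G (u', y') t)
    (Tstar : ℕ) (hT : 1 ≤ Tstar)
    (hpred : ∀ (u : ℕ → U) (x : ℕ → X), (∀ t, x (t + 1) = f (u t) (x t)) →
      ∀ t, Tstar ≤ t → G (u, fun s => g (x s)) t = g (x t)) :
    ∀ (u : ℕ → U) (x : ℕ → X), (∀ t, x (t + 1) = f (u t) (x t)) →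
      ∀ t, Tstar ≤ t →
        g '' {xt : X | ∃ x₀ : X, xt = Φ u (t - Tstar) t x₀ ∧
          ∀ s, t - Tstar ≤ s → s ≤ t - 1 →
            g (Φ u (t - Tstar) s x₀) = g (x s)} = {g (x t)} := by
  intro u x hx t ht
  obtain ⟨d, rfl⟩ := Nat.exists_eq_add_of_le' ht
  rw [Nat.add_sub_cancel]
  have hΦx : ∀ k, Φ u d (k + d) (x d) = x (k + d) := by
    intro k
    induction k with
    | zero => rw [Nat.zero_add, hΦ0]
    | succ k ih =>
      rw [Nat.add_right_comm, hΦ1 u d (k + d) _ (Nat.le_add_left d k), ih, hx]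
  ext y
  constructor
  · rintro ⟨_, ⟨x₀, rfl, hobs⟩, rfl⟩
    -- Shift time by `d`: both windows become prefixes of trajectories with the same input.
    have hreal := hpred (fun s => u (s + d)) (fun s => x (s + d))
      (fun s => by simpa only [Nat.add_right_comm s 1 d] using hx (s + d)) Tstar le_rfl
    have halt := hpred (fun s => u (s + d)) (fun s => Φ u d (s + d) x₀)
      (fun s => by
        simpa only [Nat.add_right_comm s 1 d] using hΦ1 u d (s + d) x₀ (Nat.le_add_left d s))
      Tstar le_rfl
    have hG := hcausal (fun s => u (s + d)) (fun s => u (s + d))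
      (fun s => g (Φ u d (s + d) x₀)) (fun s => g (x (s + d))) Tstar
      (fun s hs => ⟨rfl, hobs (s + d) (by omega) (by omega)⟩)
    have hout := (halt.symm.trans hG).trans hreal
    rw [Set.mem_singleton_iff]
    simpa only [Nat.add_comm] using hout
  · rintro rfl
    refine ⟨_, ⟨x d, ?_, fun s hs _ => ?_⟩, rfl⟩
    · rw [Nat.add_comm d, hΦx]
    · obtain ⟨k, rfl⟩ := Nat.exists_eq_add_of_le' hs
      rw [hΦx]
end
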